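/- arXiv:0805.2087 — 2 statements merged into one kernel-verified Lean document; each statement's English description precedes it below -/
import Mathlib

section
/- Let X and Y be compact Hausdorff spaces and f : X → Y a surjective ring-like map such that the covering dimension of Y is at least 1 and the small inductive dimension of every fiber f⁻¹(y) is at least m. Then the small inductive dimension of X is at least dim Y + m − 1. -/
open Set Topology

variable {X Y : Type*} [TopologicalSpace X] [TopologicalSpace Y]

/-- A map is fully closed if images of disjoint closed sets meet in a discrete subspace. -/
def IsFullyClosedMap (f : X → Y) : Prop :=
  ∀ F G : Set X, IsClosed F → IsClosed G → Disjoint F G →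
    DiscreteTopology ↥(f '' F ∩ f '' G)

/-- A map is ring-like if every neighborhood pair admits a smaller neighborhood of the image
point whose frontier has preimage inside the given neighborhood of the point. -/
def IsRingLike (f : X → Y) : Prop :=
  ∀ x : X, ∀ U : Set X, ∀ V : Set Y, IsOpen U → x ∈ U → IsOpen V → f x ∈ V →
    ∃ V' : Set Y, IsOpen V' ∧ f x ∈ V' ∧ V' ⊆ V ∧ f ⁻¹' (frontier V') ⊆ U

/-- A subcontinuum: a compact connected subset. -/
def IsSubcontinuum (A : Set X) : Prop := IsCompact A ∧ IsConnected A

/-- A terminal subcontinuum. -/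
def IsTerminalSubcontinuum (A : Set X) : Prop :=
  IsSubcontinuum A ∧ ∀ B : Set X, IsSubcontinuum B → A ∩ B = ∅ ∨ A ⊆ B ∨ B ⊆ A

/-- An atomic map: point-inverses (of points in the range) are terminal subcontinua. -/
def IsAtomicMap (f : X → Y) : Prop :=
  ∀ y ∈ Set.range f, IsTerminalSubcontinuum (f ⁻¹' {y})

/-- `L` is a partition in `X` between `A` and `B`. -/
def IsPartitionBetween (L A B : Set X) : Prop :=
  IsClosed L ∧ ∃ U V : Set X, IsOpen U ∧ IsOpen V ∧ Disjoint U V ∧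
    Lᶜ = U ∪ V ∧ A ⊆ U ∧ B ⊆ V

/-- Covering dimension at most `n`. -/
def CovDimLE (X : Type*) [TopologicalSpace X] (n : ℕ) : Prop :=
  ∀ (k : ℕ) (U : Fin k → Set X), (∀ i, IsOpen (U i)) → (⋃ i, U i) = Set.univ →
    ∃ (m : ℕ) (V : Fin m → Set X), (∀ j, IsOpen (V j)) ∧ (⋃ j, V j) = Set.univ ∧
      (∀ j, ∃ i, V j ⊆ U i) ∧ ∀ x : X, Set.ncard {j | x ∈ V j} ≤ n + 1

/-- `IndLE n X` means the small inductive dimension of `X` is at most `n - 1`;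
in particular `IndLE 0 X` means `X` is empty. -/
def IndLE : ℕ → (X : Type u) → [TopologicalSpace X] → Prop
  | 0, X, _ => IsEmpty X
  | n+1, X, _ => ∀ (x : X) (V : Set X), IsOpen V → x ∈ V →
      ∃ U : Set X, IsOpen U ∧ x ∈ U ∧ U ⊆ V ∧ IndLE n ↥(frontier U)

/-- Relative covering dimension less than `n`: every finite family of open sets covering `K` has a
precise open refinement that covers `K` and has order at most `n` at the points of `K`. -/
def CovDimLTOn {T : Type*} [TopologicalSpace T] (K : Set T) (n : ℕ) : Prop :=
  ∀ (ι : Type) [Finite ι] (U : ι → Set T), (∀ i, IsOpen (U i)) → K ⊆ ⋃ i, U i →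
    ∃ W : ι → Set T, (∀ i, IsOpen (W i)) ∧ (∀ i, W i ⊆ U i) ∧ K ⊆ ⋃ i, W i ∧
      ∀ y ∈ K, {i | y ∈ W i}.ncard ≤ n

/-- A finite closed family in a normal space has an open swelling of the same order. -/
theorem exists_isOpen_superset_ncard_le {T ι : Type*} [TopologicalSpace T] [NormalSpace T]
    [Finite ι] {F : ι → Set T} {n : ℕ} (hF : ∀ i, IsClosed (F i))
    (hn : ∀ y, {i | y ∈ F i}.ncard ≤ n) :
    ∃ G : ι → Set T, (∀ i, IsOpen (G i)) ∧ (∀ i, F i ⊆ G i) ∧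
      ∀ y, {i | y ∈ G i}.ncard ≤ n := by
  classical
  have key : ∀ S : Set ι, ∃ u : ι → Set T, (∀ i, IsOpen (u i)) ∧ (∀ i, F i ⊆ u i) ∧
      (n < S.ncard → ∀ y, ∃ i ∈ S, y ∉ u i) := by
    intro S
    by_cases hS : n < S.ncard
    · have hcov : (univ : Set T) ⊆ ⋃ i, (if i ∈ S then (F i)ᶜ else ∅) := by
        intro y _
        by_contra hy
        have hsub : S ⊆ {i | y ∈ F i} := by
          intro i hi
          by_contra hyi
          exact hy (mem_iUnion.2 ⟨i, by simpa [hi] using hyi⟩)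
        have := ncard_le_ncard hsub
        have := hn y
        omega
      obtain ⟨v, hv, -, hvF⟩ := exists_subset_iUnion_closure_subset isClosed_univ
        (u := fun i => if i ∈ S then (F i)ᶜ else ∅)
        (fun i => by split_ifs; exacts [(hF i).isOpen_compl, isOpen_empty])
        (fun _ _ => toFinite _) hcov
      refine ⟨fun i => (closure (v i))ᶜ, fun i => isClosed_closure.isOpen_compl, ?_, ?_⟩
      · intro i y hy hyv
        have := hvF i hyv
        split_ifs at this
        exacts [this hy, this]
      · intro _ y
        obtain ⟨i, hi⟩ := mem_iUnion.1 (hv (mem_univ y))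
        have hi' := hvF i (subset_closure hi)
        split_ifs at hi' with h
        · exact ⟨i, h, fun hc => hc (subset_closure hi)⟩
        · exact hi'.elim
    · exact ⟨fun _ => univ, fun _ => isOpen_univ, fun _ => subset_univ _, fun h => absurd h hS⟩
  choose u uo uF hu using key
  refine ⟨fun i => ⋂ S, u S i, fun i => isOpen_iInter_of_finite fun S => uo S i,
    fun i => subset_iInter fun S => uF S i, fun y => ?_⟩
  by_contra! h
  obtain ⟨i, hi, hyi⟩ := hu _ h y
  exact hyi (mem_iInter.1 hi _)

namespace CovDimLTOn

theorem empty {T : Type*} [TopologicalSpace T] (n : ℕ) : CovDimLTOn (∅ : Set T) n :=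
  fun _ _ U hU _ => ⟨U, hU, fun _ => Subset.rfl, empty_subset _, fun _ h => h.elim⟩

theorem of_subsingleton {T : Type*} [TopologicalSpace T] {K : Set T} (hK : K.Subsingleton)
    (n : ℕ) : CovDimLTOn K (n + 1) := by
  classical
  intro ι _ U hU hc
  rcases K.eq_empty_or_nonempty with rfl | ⟨p, hp⟩
  · exact empty _ ι U hU hc
  obtain ⟨i₀, hi₀⟩ := mem_iUnion.1 (hc hp)
  refine ⟨fun i => if i = i₀ then U i else ∅, fun i => ?_, fun i => ?_, fun y hy => ?_,
    fun y _ => ?_⟩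
  · dsimp only; split_ifs; exacts [hU i, isOpen_empty]
  · dsimp only; split_ifs; exacts [Subset.rfl, empty_subset _]
  · exact mem_iUnion.2 ⟨i₀, by simpa [hK hy hp] using hi₀⟩
  · have hsub : {i | y ∈ if i = i₀ then U i else ∅} ⊆ {i₀} := by
      intro i hi
      by_contra hne
      simp_all
    have := ncard_le_ncard hsub
    rw [ncard_singleton] at this
    exact this.trans (Nat.le_add_left 1 n)

/-- The cover can be modified off a closed set to get small order on this set only. -/
theorem exists_refinement {T : Type*} [TopologicalSpace T] {K L : Set T} {n : ℕ}
    (h : CovDimLTOn K n) (hK : IsClosed K) (hKL : K ⊆ L) {ι : Type} [Finite ι] {U : ι → Set T}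
    (hU : ∀ i, IsOpen (U i)) (hc : L ⊆ ⋃ i, U i) :
    ∃ W : ι → Set T, (∀ i, IsOpen (W i)) ∧ (∀ i, W i ⊆ U i) ∧ L ⊆ ⋃ i, W i ∧
      ∀ y ∈ K, {i | y ∈ W i}.ncard ≤ n := by
  obtain ⟨W, hW, hWU, hWc, hn⟩ := h ι U hU (hKL.trans hc)
  refine ⟨fun i => W i ∪ (U i \ K), fun i => (hW i).union ((hU i).sdiff hK),
    fun i => union_subset (hWU i) sdiff_subset, fun y hy => ?_, fun y hy => ?_⟩
  · by_cases hyK : y ∈ K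
    · obtain ⟨i, hi⟩ := mem_iUnion.1 (hWc hyK)
      exact mem_iUnion.2 ⟨i, Or.inl hi⟩
    · obtain ⟨i, hi⟩ := mem_iUnion.1 (hc hy)
      exact mem_iUnion.2 ⟨i, Or.inr ⟨hi, hyK⟩⟩
  · exact (ncard_le_ncard fun i hi => hi.resolve_right fun h => h.2 hy).trans (hn y hy)

theorem union {T : Type*} [TopologicalSpace T] {K L : Set T} {n : ℕ}
    (hKn : CovDimLTOn K n) (hLn : CovDimLTOn L n) (hK : IsClosed K) (hL : IsClosed L) :
    CovDimLTOn (K ∪ L) n := by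
  intro ι _ U hU hc
  obtain ⟨V, hV, hVU, hVc, hVn⟩ := hKn.exists_refinement hK subset_union_left hU hc
  obtain ⟨W, hW, hWV, hWc, hWn⟩ := hLn.exists_refinement hL subset_union_right hV hVc
  refine ⟨W, hW, fun i => (hWV i).trans (hVU i), hWc, ?_⟩
  rintro y (hy | hy)
  · exact (ncard_le_ncard fun i hi => hWV i hi).trans (hVn y hy)
  · exact hWn y hy

theorem biUnion_finset {T α : Type*} [TopologicalSpace T] {n : ℕ} (t : Finset α)
    {K : α → Set T} (hK : ∀ a ∈ t, IsClosed (K a)) (h : ∀ a ∈ t, CovDimLTOn (K a) n) :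
    CovDimLTOn (⋃ a ∈ t, K a) n := by
  classical
  induction t using Finset.induction_on with
  | empty => simpa using empty n
  | insert a s _ ih =>
    rw [Finset.set_biUnion_insert]
    exact (h a (by simp)).union
      (ih (fun b hb => hK b (by simp [hb])) (fun b hb => h b (by simp [hb])))
      (hK a (by simp)) (s.finite_toSet.isClosed_biUnion fun b hb => hK b (by simp_all))

/-- In a normal space, a refinement can be chosen with small order on the whole space. -/
theorem exists_refinement_order {T : Type*} [TopologicalSpace T] [NormalSpace T] {K : Set T}
    {n : ℕ} (h : CovDimLTOn K n) (hK : IsClosed K) {ι : Type} [Finite ι] {U : ι → Set T}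
    (hU : ∀ i, IsOpen (U i)) (hc : K ⊆ ⋃ i, U i) :
    ∃ W : ι → Set T, (∀ i, IsOpen (W i)) ∧ (∀ i, W i ⊆ U i) ∧ K ⊆ ⋃ i, W i ∧
      ∀ y, {i | y ∈ W i}.ncard ≤ n := by
  obtain ⟨W, hW, hWU, hWc, hn⟩ := h ι U hU hc
  obtain ⟨v, hvc, -, hvW⟩ := exists_subset_iUnion_closure_subset hK hW (fun _ _ => toFinite _) hWc
  obtain ⟨G, hG, hFG, hGn⟩ := exists_isOpen_superset_ncard_le (F := fun i => closure (v i) ∩ K)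
    (n := n) (fun i => isClosed_closure.inter hK) (fun y => by
      by_cases hy : y ∈ K
      · exact (ncard_le_ncard fun i hi => hvW i hi.1).trans (hn y hy)
      · simp [hy])
  refine ⟨fun i => G i ∩ U i, fun i => (hG i).inter (hU i), fun i => inter_subset_right,
    fun y hy => ?_, fun y => (ncard_le_ncard fun i hi => hi.1).trans (hGn y)⟩
  obtain ⟨i, hi⟩ := mem_iUnion.1 (hvc hy)
  exact mem_iUnion.2 ⟨i, hFG i ⟨subset_closure hi, hy⟩, hWU i (hvW i (subset_closure hi))⟩

theorem image_iff {S T : Type*} [TopologicalSpace S] [TopologicalSpace T] {e : S → T}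
    (he : IsInducing e) {K : Set S} {n : ℕ} : CovDimLTOn (e '' K) n ↔ CovDimLTOn K n := by
  constructor
  · intro h ι _ U hU hc
    choose U' hU' hUU' using fun i => he.isOpen_iff.1 (hU i)
    obtain ⟨W, hW, hWU, hWc, hn⟩ := h ι U' hU' (by
      rintro _ ⟨x, hx, rfl⟩
      obtain ⟨i, hi⟩ := mem_iUnion.1 (hc hx)
      rw [← hUU' i] at hi
      exact mem_iUnion.2 ⟨i, hi⟩)
    refine ⟨fun i => e ⁻¹' W i, fun i => (hW i).preimage he.continuous, fun i => ?_,
      fun x hx => ?_, fun x hx => hn _ (mem_image_of_mem e hx)⟩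
    · rw [← hUU' i]
      exact preimage_mono (hWU i)
    · simpa using hWc (mem_image_of_mem e hx)
  · intro h ι _ U hU hc
    obtain ⟨W, hW, hWU, hWc, hn⟩ := h ι (fun i => e ⁻¹' U i)
      (fun i => (hU i).preimage he.continuous) (fun x hx => by
        simpa using hc (mem_image_of_mem e hx))
    choose W' hW' hWW' using fun i => he.isOpen_iff.1 (hW i)
    refine ⟨fun i => W' i ∩ U i, fun i => (hW' i).inter (hU i), fun i => inter_subset_right,
      ?_, ?_⟩
    · rintro _ ⟨x, hx, rfl⟩
      obtain ⟨i, hi⟩ := mem_iUnion.1 (hWc hx)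
      refine mem_iUnion.2 ⟨i, ?_, hWU i hi⟩
      rwa [← hWW' i] at hi
    · rintro _ ⟨x, hx, rfl⟩
      refine (ncard_le_ncard fun i hi => ?_).trans (hn x hx)
      rw [mem_ofPred_eq, ← hWW' i]
      exact hi.1

/-- The covering dimension of a compact Hausdorff space is bounded inductively by the covering
dimensions of frontiers of small neighborhoods. -/
theorem univ_succ {T : Type*} [TopologicalSpace T] [CompactSpace T] [T2Space T] {n : ℕ}
    (h : ∀ (y : T) (V : Set T), IsOpen V → y ∈ V →
      ∃ O : Set T, IsOpen O ∧ y ∈ O ∧ O ⊆ V ∧ CovDimLTOn (frontier O) n) :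
    CovDimLTOn (univ : Set T) (n + 1) := by
  intro ι _ U hU hc
  choose c hcU using fun y : T => mem_iUnion.1 (hc (mem_univ y))
  choose O hO hyO hOU hOn using fun y : T => h y (U (c y)) (hU _) (hcU y)
  obtain ⟨t, ht⟩ := isCompact_univ.elim_finite_subcover O hO
    (fun y _ => mem_iUnion.2 ⟨y, hyO y⟩)
  have hB : IsClosed (⋃ a ∈ t, frontier (O a)) :=
    t.finite_toSet.isClosed_biUnion fun _ _ => isClosed_frontier
  obtain ⟨W, hW, hWU, hWc, hWn⟩ := (biUnion_finset t (fun a _ => isClosed_frontier)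
    (fun a _ => hOn a)).exists_refinement_order hB hU ((subset_univ _).trans hc)
  let r : T → T → Prop := WellOrderingRel
  let P : T → Set T := fun a => O a \ ⋃ b ∈ {b | b ∈ t ∧ r b a}, closure (O b)
  have hP : ∀ a, IsOpen (P a) := fun a => (hO a).sdiff <|
    (t.finite_toSet.subset fun b hb => hb.1).isClosed_biUnion fun _ _ => isClosed_closure
  have hPdisj : ∀ a ∈ t, ∀ b ∈ t, ∀ y, y ∈ P a → y ∈ P b → a = b := by
    have aux : ∀ a ∈ t, ∀ b, r a b → ∀ y, y ∈ P a → y ∉ P b := fun a ha b hab y hya hyb =>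
      hyb.2 (mem_biUnion (show a ∈ {c | c ∈ t ∧ r c b} from ⟨ha, hab⟩) (subset_closure hya.1))
    intro a ha b hb y hya hyb
    rcases trichotomous_of r a b with hab | hab | hab
    · exact (aux a ha b hab y hya hyb).elim
    · exact hab
    · exact (aux b hb a hab y hyb hya).elim
  refine ⟨fun i => W i ∪ ⋃ a ∈ {a | a ∈ t ∧ c a = i}, P a,
    fun i => (hW i).union (isOpen_biUnion fun a _ => hP a), fun i => ?_, fun y _ => ?_,
    fun y _ => ?_⟩
  · refine union_subset (hWU i) (iUnion₂_subset ?_)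
    rintro a ⟨-, rfl⟩
    exact sdiff_subset.trans (hOU a)
  · by_cases hy : y ∈ ⋃ a ∈ t, frontier (O a)
    · obtain ⟨i, hi⟩ := mem_iUnion.1 (hWc hy)
      exact mem_iUnion.2 ⟨i, Or.inl hi⟩
    · have hne : {a | a ∈ t ∧ y ∈ O a}.Nonempty := by
        obtain ⟨a, ha, hya⟩ := mem_iUnion₂.1 (ht (mem_univ y))
        exact ⟨a, ha, hya⟩
      have hwf : WellFounded r := IsWellFounded.wf
      obtain ⟨hat, hya⟩ := hwf.min_mem _ hne
      refine mem_iUnion.2 ⟨c (hwf.min _ hne), Or.inr (mem_biUnion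
        (show hwf.min _ hne ∈ {a | a ∈ t ∧ c a = c (hwf.min _ hne)} from ⟨hat, rfl⟩)
        ⟨hya, fun hyc => ?_⟩)⟩
      obtain ⟨b, ⟨hbt, hba⟩, hyb⟩ := mem_iUnion₂.1 hyc
      by_cases hybO : y ∈ O b
      · exact hwf.not_lt_min _ (show b ∈ {a | a ∈ t ∧ y ∈ O a} from ⟨hbt, hybO⟩) hba
      · refine hy (mem_biUnion hbt ?_)
        rw [(hO b).frontier_eq]
        exact ⟨hyb, hybO⟩
  · have hsub : {i | y ∈ W i ∪ ⋃ a ∈ {a | a ∈ t ∧ c a = i}, P a} ⊆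
        {i | y ∈ W i} ∪ c '' {a | a ∈ t ∧ y ∈ P a} := by
      rintro i (hi | hi)
      · exact Or.inl hi
      · obtain ⟨a, ⟨hat, hai⟩, hya⟩ := mem_iUnion₂.1 hi
        exact Or.inr ⟨a, ⟨hat, hya⟩, hai⟩
    have h1 : (c '' {a | a ∈ t ∧ y ∈ P a}).ncard ≤ 1 := by
      rw [ncard_le_one]
      rintro _ ⟨a, ⟨hat, hya⟩, rfl⟩ _ ⟨b, ⟨hbt, hyb⟩, rfl⟩
      rw [hPdisj a hat b hbt y hya hyb]
    exact (ncard_le_ncard hsub).trans ((ncard_union_le _ _).trans (add_le_add (hWn y) h1))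

/-- The covering dimension of a compact Hausdorff space is determined by its components. -/
theorem univ_of_connectedComponent {T : Type*} [TopologicalSpace T] [CompactSpace T] [T2Space T]
    {n : ℕ} (h : ∀ x : T, CovDimLTOn (connectedComponent x) n) :
    CovDimLTOn (univ : Set T) n := by
  intro ι _ U hU hc
  let p : Set T → Prop := fun s => ∃ E : Set T, IsClopen E ∧ s ⊆ E ∧ ∃ W : ι → Set T,
    (∀ i, IsOpen (W i)) ∧ (∀ i, W i ⊆ U i) ∧ E ⊆ ⋃ i, W i ∧ ∀ y ∈ E, {i | y ∈ W i}.ncard ≤ n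
  have hp : p univ := by
    refine isCompact_univ.induction_on ?_ ?_ ?_ ?_
    · exact ⟨∅, isClopen_empty, Subset.rfl, U, hU, fun _ => Subset.rfl, empty_subset _,
        fun _ hy => hy.elim⟩
    · rintro s t hst ⟨E, hE, htE, hW⟩
      exact ⟨E, hE, hst.trans htE, hW⟩
    · rintro s t ⟨E, hE, hsE, V, hV, hVU, hVc, hVn⟩ ⟨F, hF, htF, W, hW, hWU, hWc, hWn⟩
      refine ⟨E ∪ F, hE.union hF, union_subset_union hsE htF,
        fun i => V i ∩ E ∪ W i \ E, fun i => ((hV i).inter hE.isOpen).union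
        ((hW i).sdiff hE.isClosed), fun i => union_subset (inter_subset_left.trans (hVU i))
        (sdiff_subset.trans (hWU i)), fun y hy => ?_, fun y hy => ?_⟩
      · by_cases hyE : y ∈ E
        · obtain ⟨i, hi⟩ := mem_iUnion.1 (hVc hyE)
          exact mem_iUnion.2 ⟨i, Or.inl ⟨hi, hyE⟩⟩
        · obtain ⟨i, hi⟩ := mem_iUnion.1 (hWc (hy.resolve_left hyE))
          exact mem_iUnion.2 ⟨i, Or.inr ⟨hi, hyE⟩⟩
      · by_cases hyE : y ∈ E
        · refine (ncard_le_ncard fun i hi => ?_).trans (hVn y hyE)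
          exact (hi.resolve_right fun h => h.2 hyE).1
        · refine (ncard_le_ncard fun i hi => ?_).trans (hWn y (hy.resolve_left hyE))
          exact (hi.resolve_left fun h => hyE h.2).1
    · intro x _
      obtain ⟨W, hW, hWU, hWc, hWn⟩ := (h x).exists_refinement_order isClosed_connectedComponent
        hU ((subset_univ _).trans hc)
      have : Nonempty {s : Set T // IsClopen s ∧ x ∈ s} := ⟨⟨univ, isClopen_univ, mem_univ x⟩⟩
      obtain ⟨⟨E, hE, hxE⟩, hEW⟩ := exists_subset_nhds_of_isCompact
        (V := fun s : {s : Set T // IsClopen s ∧ x ∈ s} => (s : Set T)) (U := ⋃ i, W i)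
        (fun a b => ⟨⟨a ∩ b, a.2.1.inter b.2.1, a.2.2, b.2.2⟩, inter_subset_left,
          inter_subset_right⟩)
        (fun s => s.2.1.isClosed.isCompact) (fun y hy => by
          rw [← connectedComponent_eq_iInter_isClopen] at hy
          exact (isOpen_iUnion hW).mem_nhds (hWc hy))
      exact ⟨E, mem_nhdsWithin_of_mem_nhds (hE.isOpen.mem_nhds hxE), E, hE, Subset.rfl, W, hW,
        hWU, hEW, fun y _ => hWn y⟩
  obtain ⟨E, -, hE, W, hW, hWU, hWc, hWn⟩ := hp
  exact ⟨W, hW, hWU, hE.trans hWc, fun y _ => hWn y (hE (mem_univ y))⟩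

theorem covDimLE {T : Type*} [TopologicalSpace T] {n : ℕ}
    (h : CovDimLTOn (univ : Set T) (n + 1)) : CovDimLE T n := by
  intro k U hU hc
  obtain ⟨W, hW, hWU, hWc, hn⟩ := h (Fin k) U hU hc.ge
  exact ⟨k, W, hW, univ_subset_iff.1 hWc, fun j => ⟨j, hWU j⟩, fun x => hn x (mem_univ x)⟩

end CovDimLTOn

universe u v

/-- The small inductive dimension is monotone. -/
theorem IndLE.of_isInducing {n : ℕ} : ∀ {S : Type u} {T : Type v} [TopologicalSpace S]
    [TopologicalSpace T] {e : S → T}, IsInducing e → IndLE n T → IndLE n S := by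
  induction n with
  | zero =>
    intro S T _ _ e _ h
    have : IsEmpty T := h
    exact Function.isEmpty e
  | succ n ih =>
    intro S T _ _ e he h x V hV hx
    obtain ⟨V', hV', rfl⟩ := he.isOpen_iff.1 hV
    obtain ⟨U, hU, hxU, hUV, hn⟩ := h (e x) V' hV' hx
    have hfr : ∀ z : frontier (e ⁻¹' U), e z ∈ frontier U := fun z =>
      he.continuous.frontier_preimage_subset U z.2
    exact ⟨e ⁻¹' U, hU.preimage he.continuous, hxU, preimage_mono hUV,
      ih ((he.comp .subtypeVal).codRestrict hfr) hn⟩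

theorem IsRingLike.restrictPreimage {S T : Type*} [TopologicalSpace S] [TopologicalSpace T]
    {f : S → T} (hf : IsRingLike f) (K : Set T) : IsRingLike (K.restrictPreimage f) := by
  rintro x U V hU hx hV hfx
  obtain ⟨U', hU', rfl⟩ := isOpen_induced_iff.1 hU
  obtain ⟨V', hV', rfl⟩ := isOpen_induced_iff.1 hV
  obtain ⟨O, hO, hxO, hOV, hOU⟩ := hf x U' V' hU' hx hV' hfx
  exact ⟨Subtype.val ⁻¹' O, hO.preimage continuous_subtype_val, hxO, preimage_mono hOV, fun z hz =>
    hOU (continuous_subtype_val.frontier_preimage_subset O hz)⟩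

/-- If the image of a point of `W` lies in a nondegenerate connected set `K`, then some fiber over
`K` is contained in `W`. -/
theorem IsRingLike.exists_fiber_subset {S T : Type*} [TopologicalSpace S] [TopologicalSpace T]
    [T1Space T] {f : S → T} (hf : IsRingLike f) {K : Set T} (hK : IsPreconnected K)
    (hnt : K.Nontrivial) {W : Set S} (hW : IsOpen W) {x : S} (hx : x ∈ W) (hxK : f x ∈ K) :
    ∃ y ∈ K, f ⁻¹' {y} ⊆ W := by
  obtain ⟨z, hz, hzx⟩ := hnt.exists_ne (f x)
  obtain ⟨O, hO, hxO, hOz, hOW⟩ := hf x W {z}ᶜ hW hx isOpen_compl_singleton hzx.symm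
  by_contra! hcon
  have hdis : Disjoint (frontier O) K := by
    rw [Set.disjoint_left]
    rintro y hy hyK
    refine hcon y hyK ?_
    rintro w rfl
    exact hOW hy
  have hcl : K ⊆ O ∪ (closure O)ᶜ := by
    intro y hy
    by_cases hyO : y ∈ O
    · exact Or.inl hyO
    · refine Or.inr fun hyc => Set.disjoint_left.1 hdis ?_ hy
      rw [hO.frontier_eq]
      exact ⟨hyc, hyO⟩
  obtain ⟨y, -, hyO, hyc⟩ := hK O (closure O)ᶜ hO isClosed_closure.isOpen_compl hcl
    ⟨f x, hxK, hxO⟩ ⟨z, hz, (hcl hz).resolve_left fun h => hOz h rfl⟩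
  exact hyc (subset_closure hyO)

theorem not_indLE_of_isRingLike (m k : ℕ) : ∀ {S : Type u} {T : Type v} [TopologicalSpace S]
    [TopologicalSpace T] [CompactSpace S] [T2Space S] [CompactSpace T] [T2Space T]
    (f : S → T), Continuous f → Function.Surjective f → IsRingLike f →
    ¬ CovDimLTOn (univ : Set T) (k + 1) → (∀ y : T, ¬ IndLE m ↥(f ⁻¹' {y})) →
    ¬ IndLE (k + m) S := by
  induction k with
  | zero =>
    intro S T _ _ _ _ _ _ f _ _ _ hdim hfib h
    rw [Nat.zero_add] at h
    have hne : Nonempty T := by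
      by_contra hT
      rw [not_nonempty_iff] at hT
      exact hdim (.of_subsingleton (fun x => isEmptyElim x) 0)
    exact hfib hne.some (h.of_isInducing .subtypeVal)
  | succ k ih =>
    intro S T _ _ _ _ _ _ f hf hsurj hr hdim hfib h
    rw [Nat.add_right_comm] at h
    have hfiber : ∀ {W : Set S}, IsOpen W → IsOpen {y | f ⁻¹' {y} ⊆ W} := by
      intro W hW
      have : {y | f ⁻¹' {y} ⊆ W} = (f '' Wᶜ)ᶜ := by
        ext y
        simp only [mem_ofPred_eq, mem_compl_iff, mem_image, not_exists, not_and, not_imp_not,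
          subset_def, mem_preimage, mem_singleton_iff]
      rw [this]
      exact (hf.isClosedMap _ hW.isClosed_compl).isOpen_compl
    obtain ⟨y₀, V, hV, hy₀, hbig⟩ : ∃ (y : T) (V : Set T), IsOpen V ∧ y ∈ V ∧
        ∀ O : Set T, IsOpen O → y ∈ O → O ⊆ V → ¬ CovDimLTOn (frontier O) (k + 1) := by
      by_contra! hcon
      exact hdim (.univ_succ hcon)
    obtain ⟨x₀, rfl⟩ := hsurj y₀
    obtain ⟨U, hU, hxU, hUV, hUind⟩ := h x₀ (f ⁻¹' V) (hV.preimage hf) hy₀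
    set A : Set T := {y | f ⁻¹' {y} ⊆ U}
    have hAo : IsOpen A := hfiber hU
    have hAV : A ⊆ V := by
      intro y hy
      obtain ⟨x, rfl⟩ := hsurj y
      exact hUV (hy rfl)
    obtain ⟨O, hO, hxO, hOV, hOU⟩ := hr x₀ U V hU hxU hV hy₀
    have hfrO : frontier O ⊆ A := by
      rintro y hy x rfl
      exact hOU hy
    have hfr : frontier (O ∪ A) ⊆ frontier A := by
      rw [(hO.union hAo).frontier_eq, hAo.frontier_eq, closure_union]
      rintro y ⟨hy | hy, hyn⟩
      · refine absurd (Or.inr (hfrO ?_)) hyn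
        rw [hO.frontier_eq]
        exact ⟨hy, fun h => hyn (Or.inl h)⟩
      · exact ⟨hy, fun h => hyn (Or.inr h)⟩
    have hC := hbig (O ∪ A) (hO.union hAo) (Or.inl hxO) (union_subset hOV hAV)
    have : CompactSpace (frontier (O ∪ A)) :=
      isCompact_iff_compactSpace.1 isClosed_frontier.isCompact
    obtain ⟨c, hc⟩ : ∃ c : frontier (O ∪ A), ¬ CovDimLTOn (connectedComponent c) (k + 1) := by
      by_contra! hcon
      have := (CovDimLTOn.image_iff .subtypeVal).2 (CovDimLTOn.univ_of_connectedComponent hcon)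
      rw [image_univ, Subtype.range_coe] at this
      exact hC this
    set K : Set T := (↑) '' connectedComponent c
    have hKdim : ¬ CovDimLTOn K (k + 1) := fun hd =>
      hc ((CovDimLTOn.image_iff .subtypeVal).1 hd)
    have hKcl : IsClosed K :=
      isClosed_frontier.isClosedEmbedding_subtypeVal.isClosedMap _ isClosed_connectedComponent
    have hKconn : IsPreconnected K :=
      isPreconnected_connectedComponent.image _ continuous_subtype_val.continuousOn
    have hKA : K ⊆ frontier A := by
      rintro _ ⟨z, -, rfl⟩
      exact hfr z.2
    have hKnt : K.Nontrivial := by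
      by_contra hn
      exact hKdim (.of_subsingleton (not_nontrivial_iff.1 hn) k)
    have hsub : f ⁻¹' K ⊆ frontier U := by
      intro x hx
      rw [hU.frontier_eq]
      constructor
      · by_contra hxc
        obtain ⟨y, hy, hyW⟩ := hr.exists_fiber_subset hKconn hKnt
          isClosed_closure.isOpen_compl hxc hx
        obtain ⟨z, hzW, hzA⟩ := mem_closure_iff.1 (frontier_subset_closure (hKA hy)) _
          (hfiber isClosed_closure.isOpen_compl) hyW
        obtain ⟨w, rfl⟩ := hsurj z
        exact hzW rfl (subset_closure (hzA rfl))
      · intro hxU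
        obtain ⟨y, hy, hyU⟩ := hr.exists_fiber_subset hKconn hKnt hU hxU hx
        have := hKA hy
        rw [hAo.frontier_eq] at this
        exact this.2 hyU
    have : CompactSpace K := isCompact_iff_compactSpace.1 hKcl.isCompact
    have : CompactSpace (f ⁻¹' K) :=
      isCompact_iff_compactSpace.1 (hKcl.preimage hf).isCompact
    refine ih (K.restrictPreimage f) hf.restrictPreimage
      (K.restrictPreimage_surjective hsurj) (hr.restrictPreimage K) (fun hd => hKdim ?_)
      (fun y hy => hfib y ?_) (hUind.of_isInducing (Topology.IsEmbedding.inclusion hsub).isInducing)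
    · have := (CovDimLTOn.image_iff (e := ((↑) : K → T)) .subtypeVal).2 hd
      rwa [image_univ, Subtype.range_coe] at this
    · have hmem : ∀ x : f ⁻¹' {(y : T)}, (x : S) ∈ f ⁻¹' K := fun x => by
        have hx : f x = y := x.2
        rw [mem_preimage, hx]
        exact y.2
      exact hy.of_isInducing ((IsInducing.subtypeVal.codRestrict hmem).codRestrict
        (s := K.restrictPreimage f ⁻¹' {y}) fun x => Subtype.ext x.2)

theorem statement14 {X Y : Type*} [TopologicalSpace X] [TopologicalSpace Y]
    [CompactSpace X] [T2Space X] [CompactSpace Y] [T2Space Y]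
    (f : X → Y) (hf : Continuous f) (hsurj : Function.Surjective f)
    (hr : IsRingLike f) (k m : ℕ) (hk : 1 ≤ k)
    (hdim : ¬ CovDimLE Y (k - 1))
    (hfib : ∀ y : Y, ¬ IndLE m ↥(f ⁻¹' {y})) :
    ¬ IndLE (k + m - 1) X := by
  obtain ⟨k, rfl⟩ := Nat.exists_eq_add_of_le' hk
  rw [show k + 1 + m - 1 = k + m by omega]
  exact not_indLE_of_isRingLike m k f hf hsurj hr (fun h => hdim h.covDimLE) hfib
end

section
/- Let X be a metrizable Cook continuum. Then X is not Suslinian; that is, X contains an uncountable family of pairwise disjoint non-degenerate subcontinua. -/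
open Set Topology

variable {X Y : Type*} [TopologicalSpace X] [TopologicalSpace Y]

/-- A space with an uncountable family of pairwise disjoint non-degenerate subcontinua. -/
def HasUncountableDisjointSubcontinua (X : Type*) [TopologicalSpace X] : Prop :=
  ∃ 𝒞 : Set (Set X), ¬ 𝒞.Countable ∧
    (∀ A ∈ 𝒞, IsSubcontinuum A ∧ A.Nontrivial) ∧
    𝒞.Pairwise (fun A B => Disjoint A B)

namespace HasUncountableDisjointSubcontinua

lemma of_indexed {X : Type*} [TopologicalSpace X] {ι : Type*} [Uncountable ι] (f : ι → Set X)
    (hf : ∀ i, IsSubcontinuum (f i) ∧ (f i).Nontrivial)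
    (hd : ∀ i j, i ≠ j → Disjoint (f i) (f j)) : HasUncountableDisjointSubcontinua X := by
  have hinj : Function.Injective f := by
    intro i j hij
    by_contra hne
    have := hd i j hne
    rw [hij, disjoint_self] at this
    exact (hf j).2.nonempty.ne_empty this
  refine ⟨range f, fun hc => ?_, ?_, ?_⟩
  · have : Countable (range f) := hc
    have : Countable ι := (rangeFactorization_injective.2 hinj).countable
    exact not_countable this
  · rintro _ ⟨i, rfl⟩
    exact hf i
  · rintro _ ⟨i, rfl⟩ _ ⟨j, rfl⟩ hne
    exact hd i j fun h => hne (h ▸ rfl)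

lemma of_injective {X Y : Type*} [TopologicalSpace X] [TopologicalSpace Y]
    (h : HasUncountableDisjointSubcontinua X) {f : X → Y} (hf : Continuous f)
    (hinj : Function.Injective f) : HasUncountableDisjointSubcontinua Y := by
  obtain ⟨𝒞, hc, hC, hd⟩ := h
  have : Uncountable 𝒞 := ⟨hc⟩
  refine of_indexed (fun A : 𝒞 => f '' A) (fun A => ?_) fun A B hAB => ?_
  · obtain ⟨⟨h1, h2⟩, h3⟩ := hC A A.2
    exact ⟨⟨h1.image hf, h2.image f hf.continuousOn⟩, h3.image hinj⟩
  · exact (disjoint_image_iff hinj).2 (hd A.2 B.2 fun h => hAB (Subtype.ext h))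

end HasUncountableDisjointSubcontinua

section Connectedness

lemma isPreconnected_iInter_of_directed {X : Type*} [TopologicalSpace X] [CompactSpace X]
    [T2Space X] {ι : Type*} [Nonempty ι] {f : ι → Set X} (hd : Directed (· ⊇ ·) f)
    (hc : ∀ i, IsClosed (f i)) (hp : ∀ i, IsPreconnected (f i)) : IsPreconnected (⋂ i, f i) := by
  rw [isPreconnected_iff_subset_of_fully_disjoint_closed (isClosed_iInter hc)]
  intro u v hu hv huv hdisj
  obtain ⟨U, V, hU, hV, huU, hvV, hUV⟩ := normal_separation hu hv hdisj
  obtain ⟨i, hi⟩ := exists_subset_nhds_of_isCompact hd (fun i => (hc i).isCompact)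
    (U := U ∪ V) fun x hx => (hU.union hV).mem_nhds (union_subset_union huU hvV (huv hx))
  rcases (hp i).subset_or_subset hU hV hUV hi with h | h
  · left
    intro x hx
    rcases huv hx with hxu | hxv
    · exact hxu
    · exact (hUV.le_bot ⟨h (mem_iInter.1 hx i), hvV hxv⟩).elim
  · right
    intro x hx
    rcases huv hx with hxu | hxv
    · exact (hUV.le_bot ⟨huU hxu, h (mem_iInter.1 hx i)⟩).elim
    · exact hxv

/-- A separation of `W ∪ F`, with `W` open and disjoint from `F`, cannot split off a part of `W`. -/
lemma union_subset_of_subset_left {X : Type*} [TopologicalSpace X] [PreconnectedSpace X]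
    {W F C D : Set X} (hW : IsOpen W) (hWF : IsClosed (W ∪ F)) (hne : F.Nonempty)
    (hC : IsClosed C) (hD : IsClosed D) (hCD : Disjoint C D) (hsub : W ∪ F ⊆ C ∪ D)
    (hFC : F ⊆ C) : W ∪ F ⊆ C := by
  have heq : (W ∪ F) ∩ D = W ∩ Cᶜ := by
    ext x
    have h1 := @hsub x
    have h2 := @hFC x
    have h3 : x ∈ C → x ∉ D := fun a b => hCD.le_bot ⟨a, b⟩
    simp only [mem_inter_iff, mem_union, mem_compl_iff] at *
    tauto
  have hclopen : IsClopen (W ∩ Cᶜ) := ⟨heq ▸ hWF.inter hD, hW.inter hC.isOpen_compl⟩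
  rcases isClopen_iff.1 hclopen with h | h
  · intro x hx
    by_contra hxC
    have : x ∈ W ∩ Cᶜ := heq ▸ ⟨hx, (hsub hx).resolve_left hxC⟩
    rw [h] at this
    exact this
  · obtain ⟨y, hy⟩ := hne
    exact ((h ▸ mem_univ y : y ∈ W ∩ Cᶜ).2 (hFC hy)).elim

lemma isPreconnected_union_of_isOpen {X : Type*} [TopologicalSpace X] [PreconnectedSpace X]
    {W F : Set X} (hW : IsOpen W) (hWF : IsClosed (W ∪ F)) (hne : F.Nonempty)
    (hF : IsPreconnected F) (hFc : IsClosed F) : IsPreconnected (W ∪ F) := by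
  rw [isPreconnected_iff_subset_of_fully_disjoint_closed hWF]
  intro C D hC hD hsub hCD
  rcases (isPreconnected_iff_subset_of_fully_disjoint_closed hFc).1 hF C D hC hD
    (subset_union_right.trans hsub) hCD with h | h
  · exact .inl (union_subset_of_subset_left hW hWF hne hC hD hCD hsub h)
  · exact .inr (union_subset_of_subset_left hW hWF hne hD hC hCD.symm
      (by rwa [union_comm D C]) h)

/-- A weak form of the boundary bumping theorem. -/
lemma exists_nontrivial_subset_compl {X : Type*} [TopologicalSpace X] [CompactSpace X] [T2Space X]
    [PreconnectedSpace X] {U : Set X} (hU : IsOpen U) (hne : U.Nonempty) {p : X}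
    (hp : p ∉ closure U) :
    ∃ K : Set X, IsClosed K ∧ IsPreconnected K ∧ p ∈ K ∧ K ⊆ Uᶜ ∧ K.Nontrivial := by
  have hpU : p ∈ Uᶜ := fun h => hp (subset_closure h)
  have hUc : IsClosed Uᶜ := hU.isClosed_compl
  have : CompactSpace ↥(Uᶜ) := isCompact_iff_compactSpace.1 hUc.isCompact
  let q : ↥(Uᶜ) := ⟨p, hpU⟩
  refine ⟨(↑) '' connectedComponent q,
    hUc.isClosedEmbedding_subtypeVal.isClosedMap _ isClosed_connectedComponent,
    isPreconnected_connectedComponent.image _ continuous_subtype_val.continuousOn,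
    ⟨q, mem_connectedComponent, rfl⟩, ?_, ?_⟩
  · rintro _ ⟨x, -, rfl⟩
    exact x.2
  by_contra hnt
  rw [not_nontrivial_iff] at hnt
  have hsingle : connectedComponent q ⊆ {q} := fun x hx =>
    Subtype.ext (hnt ⟨x, hx, rfl⟩ ⟨q, mem_connectedComponent, rfl⟩)
  have hO : IsOpen ((↑) ⁻¹' (closure U)ᶜ : Set ↥(Uᶜ)) :=
    isClosed_closure.isOpen_compl.preimage continuous_subtype_val
  have : Nonempty { s : Set ↥(Uᶜ) // IsClopen s ∧ q ∈ s } :=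
    ⟨⟨univ, isClopen_univ, mem_univ _⟩⟩
  obtain ⟨⟨V, hV, hqV⟩, hVO⟩ := exists_subset_nhds_of_isCompact
    (V := fun s : { s : Set ↥(Uᶜ) // IsClopen s ∧ q ∈ s } => (s : Set ↥(Uᶜ)))
    (U := ((↑) ⁻¹' (closure U)ᶜ : Set ↥(Uᶜ)))
    (fun s t => ⟨⟨s.1 ∩ t.1, s.2.1.inter t.2.1, s.2.2, t.2.2⟩, inter_subset_left,
      inter_subset_right⟩)
    (fun s => s.2.1.1.isCompact) (by
      rw [← connectedComponent_eq_iInter_isClopen]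
      intro x hx
      obtain rfl := hsingle hx
      exact hO.mem_nhds hp)
  have hclosed : IsClosed ((↑) '' V : Set X) :=
    hUc.isClosedEmbedding_subtypeVal.isClosedMap _ hV.1
  have hopen : IsOpen ((↑) '' V : Set X) := by
    obtain ⟨O, hO', rfl⟩ := isOpen_induced_iff.1 hV.2
    have : ((↑) '' ((↑) ⁻¹' O : Set ↥(Uᶜ)) : Set X) = O ∩ (closure U)ᶜ := by
      ext x
      constructor
      · rintro ⟨y, hy, rfl⟩
        exact ⟨hy, hVO hy⟩
      · rintro ⟨h1, h2⟩
        exact ⟨⟨x, fun h => h2 (subset_closure h)⟩, h1, rfl⟩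
    rw [this]
    exact hO'.inter isClosed_closure.isOpen_compl
  rcases isClopen_iff.1 ⟨hclosed, hopen⟩ with h | h
  · have : p ∈ ((↑) '' V : Set X) := ⟨q, hqV, rfl⟩
    rw [h] at this
    exact this
  · obtain ⟨y, hy⟩ := hne
    obtain ⟨z, -, rfl⟩ := (h ▸ mem_univ y : y ∈ ((↑) '' V : Set X))
    exact z.2 hy

end Connectedness

section Indecomposable

variable {M : Type*} [TopologicalSpace M]

/-- A space that is not the union of two proper closed connected subsets. -/
def IsIndecomposableSpace (M : Type*) [TopologicalSpace M] : Prop :=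
  ∀ A B : Set M, IsClosed A → IsPreconnected A → IsClosed B → IsPreconnected B →
    A ∪ B = univ → A = univ ∨ B = univ

lemma IsIndecomposableSpace.interior_eq_empty [PreconnectedSpace M] (hI : IsIndecomposableSpace M)
    {K : Set M} (hK : IsClosed K) (hKp : IsPreconnected K) (hne : K ≠ univ) : interior K = ∅ := by
  by_contra hint
  rw [← ne_eq, ← nonempty_iff_ne_empty] at hint
  have hKne : K.Nonempty := hint.mono interior_subset
  by_cases hp : IsPreconnected Kᶜ
  · rcases hI K (closure Kᶜ) hK hKp isClosed_closure hp.closure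
      (eq_univ_of_univ_subset fun x _ => (em (x ∈ K)).imp id fun h => subset_closure h) with h | h
    · exact hne h
    · rw [closure_compl, compl_univ_iff] at h
      exact hint.ne_empty h
  · rw [isPreconnected_iff_subset_of_disjoint] at hp
    push Not at hp
    obtain ⟨U, V, hU, hV, hUV, hdisj, hnU, hnV⟩ := hp
    have key : ∀ U V : Set M, IsOpen U → IsOpen V → Kᶜ ⊆ U ∪ V → Kᶜ ∩ (U ∩ V) = ∅ →
        IsClosed ((Kᶜ ∩ U) ∪ K) ∧ IsPreconnected ((Kᶜ ∩ U) ∪ K) := by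
      intro U V hU hV hUV hdisj
      have heq : (Kᶜ ∩ U) ∪ K = (Kᶜ ∩ V)ᶜ := by
        ext x
        have h1 := @hUV x
        have h2 : x ∉ Kᶜ ∩ (U ∩ V) := by simp [hdisj]
        simp only [mem_inter_iff, mem_union, mem_compl_iff] at *
        tauto
      have hcl : IsClosed ((Kᶜ ∩ U) ∪ K) := by
        rw [heq]
        exact (hK.isOpen_compl.inter hV).isClosed_compl
      exact ⟨hcl, isPreconnected_union_of_isOpen (hK.isOpen_compl.inter hU) hcl hKne hKp hK⟩
    obtain ⟨h1, h2⟩ := key U V hU hV hUV hdisj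
    obtain ⟨h3, h4⟩ := key V U hV hU (by rwa [union_comm]) (by rwa [inter_comm V])
    have aux : ∀ W : Set M, (Kᶜ ∩ W) ∪ K = univ → Kᶜ ⊆ W := fun W h x hx =>
      ((h ▸ mem_univ x : x ∈ (Kᶜ ∩ W) ∪ K).resolve_right hx).2
    rcases hI _ _ h1 h2 h3 h4 (eq_univ_of_univ_subset fun x _ => by
      have h1 := @hUV x
      simp only [mem_inter_iff, mem_union, mem_compl_iff] at *
      tauto) with h | h
    · exact hnU (aux _ h)
    · exact hnV (aux _ h)

/-- Two points lie in a common proper closed connected subset. -/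
def SameComposant (p q : M) : Prop :=
  ∃ K : Set M, IsClosed K ∧ IsPreconnected K ∧ K ≠ univ ∧ p ∈ K ∧ q ∈ K

lemma isMeagre_setOf_sameComposant [PreconnectedSpace M] [SecondCountableTopology M]
    (hI : IsIndecomposableSpace M) (p : M) : IsMeagre {q | SameComposant p q} := by
  let B := TopologicalSpace.countableBasis M
  have hB := TopologicalSpace.isBasis_countableBasis M
  have : {q | SameComposant p q} ⊆ ⋃ U ∈ B, closure (connectedComponentIn Uᶜ p) := by
    rintro q ⟨K, hK, hKp, hne, hpK, hqK⟩
    obtain ⟨x, hx⟩ := (ne_univ_iff_exists_notMem K).1 hne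
    obtain ⟨U, hUB, -, hUK⟩ := hB.mem_nhds_iff.1 (hK.isOpen_compl.mem_nhds hx)
    exact mem_biUnion hUB (subset_closure
      (hKp.subset_connectedComponentIn hpK (subset_compl_comm.1 hUK) hqK))
  refine (isMeagre_biUnion (TopologicalSpace.countable_countableBasis M) fun U hU => ?_).mono this
  have hsub : closure (connectedComponentIn Uᶜ p) ⊆ Uᶜ :=
    closure_minimal (connectedComponentIn_subset _ _) (hB.isOpen hU).isClosed_compl
  have hnd : IsNowhereDense (closure (connectedComponentIn Uᶜ p)) := by
    rw [IsNowhereDense, closure_closure]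
    refine hI.interior_eq_empty isClosed_closure isPreconnected_connectedComponentIn.closure ?_
    intro h
    rw [h, univ_subset_iff, compl_univ_iff] at hsub
    exact TopologicalSpace.nonempty_of_mem_countableBasis hU |>.ne_empty hsub
  exact hnd.isMeagre

/-- The relation `SameComposant` as an equivalence relation. -/
def composantSetoid [Nontrivial M] [T1Space M] (hI : IsIndecomposableSpace M) : Setoid M where
  r := SameComposant
  iseqv :=
    { refl := fun p => by
        obtain ⟨q, hq⟩ := exists_ne p
        exact ⟨{p}, isClosed_singleton, isPreconnected_singleton,
          (ne_univ_iff_exists_notMem _).2 ⟨q, hq⟩, rfl, rfl⟩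
      symm := fun ⟨K, h1, h2, h3, h4, h5⟩ => ⟨K, h1, h2, h3, h5, h4⟩
      trans := fun {_ y _} ⟨K, h1, h2, h3, h4, h5⟩ ⟨L, k1, k2, k3, k4, k5⟩ =>
        ⟨K ∪ L, h1.union k1, h2.union y h5 k4 k2,
          fun h => (hI K L h1 h2 k1 k2 h).elim h3 k3, .inl h4, .inr k5⟩ }

lemma IsIndecomposableSpace.hasUncountableDisjointSubcontinua [CompactSpace M] [T2Space M]
    [SecondCountableTopology M] [PreconnectedSpace M] [Nontrivial M]
    (hI : IsIndecomposableSpace M) : HasUncountableDisjointSubcontinua M := by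
  let S := composantSetoid hI
  have hK : ∀ p : M, ∃ K : Set M, IsClosed K ∧ IsPreconnected K ∧ p ∈ K ∧ K ≠ univ ∧
      K.Nontrivial := by
    intro p
    obtain ⟨q, hq⟩ := exists_ne p
    obtain ⟨U, V, hU, hV, hpU, hqV, hUV⟩ := t2_separation hq.symm
    obtain ⟨K, h1, h2, h3, h4, h5⟩ := exists_nontrivial_subset_compl hV ⟨q, hqV⟩
      (p := p) fun h => (hUV.closure_right hU).le_bot ⟨hpU, h⟩
    exact ⟨K, h1, h2, h3, (ne_univ_iff_exists_notMem _).2 ⟨q, fun h => h4 h hqV⟩, h5⟩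
  choose K hKc hKp hpK hKne hKnt using hK
  have : Uncountable (Quotient S) := by
    refine ⟨fun hcount => ?_⟩
    have hm : IsMeagre (⋃ c : Quotient S, {q : M | SameComposant c.out q}) :=
      isMeagre_iUnion fun c => isMeagre_setOf_sameComposant hI _
    have huniv : (⋃ c : Quotient S, {q : M | SameComposant c.out q}) = univ :=
      eq_univ_of_univ_subset fun q _ => mem_iUnion.2 ⟨⟦q⟧, Quotient.mk_out (s := S) q⟩
    rw [huniv] at hm
    exact not_isMeagre_of_isOpen isOpen_univ univ_nonempty hm
  refine .of_indexed (fun c : Quotient S => K c.out)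
    (fun c => ⟨⟨(hKc _).isCompact, ⟨_, hpK _⟩, hKp _⟩, hKnt _⟩) fun c d hcd => ?_
  rw [disjoint_left]
  intro x hxc hxd
  refine hcd (Quotient.out_equiv_out.1 ?_)
  have h1 : S.r c.out x := ⟨K c.out, hKc _, hKp _, hKne _, hpK _, hxc⟩
  have h2 : S.r x d.out := ⟨K d.out, hKc _, hKp _, hKne _, hxd, hpK _⟩
  exact S.trans h1 h2

lemma exists_decomposition [CompactSpace M] [T2Space M] [SecondCountableTopology M]
    (h : ¬ HasUncountableDisjointSubcontinua M) {N : Set M} (hN : IsClosed N)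
    (hNp : IsPreconnected N) (hnt : N.Nontrivial) :
    ∃ A B : Set M, IsClosed A ∧ IsPreconnected A ∧ IsClosed B ∧ IsPreconnected B ∧
      A ∪ B = N ∧ A ≠ N ∧ B ≠ N := by
  have : CompactSpace N := isCompact_iff_compactSpace.1 hN.isCompact
  have : PreconnectedSpace N := isPreconnected_iff_preconnectedSpace.1 hNp
  have : Nontrivial N := nontrivial_coe_sort.2 hnt
  have hI : ¬ IsIndecomposableSpace N := fun hI =>
    h (hI.hasUncountableDisjointSubcontinua.of_injective continuous_subtype_val
      Subtype.val_injective)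
  unfold IsIndecomposableSpace at hI
  push Not at hI
  obtain ⟨A, B, hA, hAp, hB, hBp, hAB, hAne, hBne⟩ := hI
  have hcl := hN.isClosedEmbedding_subtypeVal.isClosedMap
  have hne : ∀ C : Set N, C ≠ univ → ((↑) '' C : Set M) ≠ N := fun C hC h => by
    refine hC (Subtype.val_injective.image_injective ?_)
    rw [h, image_univ, Subtype.range_val]
  exact ⟨(↑) '' A, (↑) '' B, hcl A hA, hAp.image _ continuous_subtype_val.continuousOn, hcl B hB,
    hBp.image _ continuous_subtype_val.continuousOn,
    by rw [← image_union, hAB, image_univ, Subtype.range_val], hne A hAne, hne B hBne⟩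

end Indecomposable

section Irreducible

variable {P : Type*} [TopologicalSpace P]

/-- The space is irreducible between the points `a` and `b`. -/
def IsIrreducibleBetween (a b : P) : Prop :=
  ∀ Q : Set P, IsClosed Q → IsPreconnected Q → a ∈ Q → b ∈ Q → Q = univ

/-- A pair of disjoint closed connected sets, the first containing `a` and the second `b`. -/
structure EndPair (a b : P) where
  /-- The side of `a`. -/
  left : Set P
  /-- The side of `b`. -/
  right : Set P
  isClosed_left : IsClosed left
  isClosed_right : IsClosed right
  isPreconnected_left : IsPreconnected left
  isPreconnected_right : IsPreconnected right
  mem_left : a ∈ left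
  mem_right : b ∈ right
  disjoint : Disjoint left right

variable {a b : P}

/-- The closure of the complement of the two sides. -/
def EndPair.gap (N : EndPair a b) : Set P := closure (N.left ∪ N.right)ᶜ

lemma EndPair.isClosed_union (N : EndPair a b) : IsClosed (N.left ∪ N.right) :=
  N.isClosed_left.union N.isClosed_right

lemma EndPair.left_union_gap_union_right (N : EndPair a b) :
    N.left ∪ N.gap ∪ N.right = univ := by
  refine eq_univ_of_univ_subset fun x _ => ?_
  by_cases h : x ∈ N.left ∪ N.right
  · exact h.elim (fun h => .inl (.inl h)) .inr
  · exact .inl (.inr (subset_closure h))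

lemma EndPair.exists_separation [PreconnectedSpace P] (hirr : IsIrreducibleBetween a b)
    (N : EndPair a b) {W : Set P}
    (hW : IsOpen W) (hcl : IsClosed (W ∪ (N.left ∪ N.right)))
    (hne : W ∪ (N.left ∪ N.right) ≠ univ) :
    ∃ C D : Set P, IsClosed C ∧ IsClosed D ∧ Disjoint C D ∧ C ∪ D = W ∪ (N.left ∪ N.right) ∧
      N.left ⊆ C ∧ N.right ⊆ D := by
  have hnp : ¬ IsPreconnected (W ∪ (N.left ∪ N.right)) := fun h =>
    hne (hirr _ hcl h (.inr (.inl N.mem_left)) (.inr (.inr N.mem_right)))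
  rw [isPreconnected_iff_subset_of_fully_disjoint_closed hcl] at hnp
  push Not at hnp
  obtain ⟨C, D, hC, hD, hsub, hdisj, hnC, hnD⟩ := hnp
  have hFne : (N.left ∪ N.right).Nonempty := ⟨a, .inl N.mem_left⟩
  have aux : ∀ S ⊆ W ∪ (N.left ∪ N.right), IsClosed S → IsPreconnected S → S ⊆ C ∨ S ⊆ D :=
    fun S hS hSc hSp => (isPreconnected_iff_subset_of_fully_disjoint_closed hSc).1 hSp C D hC hD
      (hS.trans hsub) hdisj
  have key : ∀ C D : Set P, IsClosed C → IsClosed D → W ∪ (N.left ∪ N.right) ⊆ C ∪ D →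
      Disjoint C D → N.left ⊆ C → N.right ⊆ D →
      ∃ C D : Set P, IsClosed C ∧ IsClosed D ∧ Disjoint C D ∧
        C ∪ D = W ∪ (N.left ∪ N.right) ∧ N.left ⊆ C ∧ N.right ⊆ D := by
    intro C D hC hD hsub hdisj hl hr
    refine ⟨(W ∪ (N.left ∪ N.right)) ∩ C, (W ∪ (N.left ∪ N.right)) ∩ D, hcl.inter hC,
      hcl.inter hD, hdisj.mono inter_subset_right inter_subset_right, ?_,
      fun x hx => ⟨.inr (.inl hx), hl hx⟩, fun x hx => ⟨.inr (.inr hx), hr hx⟩⟩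
    rw [← inter_union_distrib_left, inter_eq_left.2 hsub]
  have hl : N.left ⊆ W ∪ (N.left ∪ N.right) := subset_union_left.trans subset_union_right
  have hr : N.right ⊆ W ∪ (N.left ∪ N.right) := subset_union_right.trans subset_union_right
  rcases aux _ hl N.isClosed_left N.isPreconnected_left with h1 | h1 <;>
    rcases aux _ hr N.isClosed_right N.isPreconnected_right with h2 | h2
  · exact (hnC (union_subset_of_subset_left hW hcl hFne hC hD hdisj hsub
      (union_subset h1 h2))).elim
  · exact key C D hC hD hsub hdisj h1 h2
  · exact key D C hD hC (by rwa [union_comm D]) hdisj.symm h1 h2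
  · exact (hnD (union_subset_of_subset_left hW hcl hFne hD hC hdisj.symm
      (by rwa [union_comm D]) (union_subset h1 h2))).elim

lemma EndPair.isPreconnected_compl [PreconnectedSpace P] (hirr : IsIrreducibleBetween a b)
    (N : EndPair a b) :
    IsPreconnected (N.left ∪ N.right)ᶜ := by
  rw [isPreconnected_iff_subset_of_disjoint]
  intro U V hU hV hUV hdisj
  by_contra! hn
  obtain ⟨hnU, hnV⟩ := hn
  have hG : IsOpen (N.left ∪ N.right)ᶜ := N.isClosed_union.isOpen_compl
  have key : ∀ U V : Set P, IsOpen U → IsOpen V → (N.left ∪ N.right)ᶜ ⊆ U ∪ V →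
      (N.left ∪ N.right)ᶜ ∩ (U ∩ V) = ∅ → ¬ (N.left ∪ N.right)ᶜ ⊆ U →
      ∃ C D : Set P, IsClosed C ∧ IsClosed D ∧ Disjoint C D ∧
        C ∪ D = ((N.left ∪ N.right)ᶜ ∩ U) ∪ (N.left ∪ N.right) ∧ N.left ⊆ C ∧ N.right ⊆ D := by
    intro U V hU hV hUV hdisj hnU
    have heq : ((N.left ∪ N.right)ᶜ ∩ U) ∪ (N.left ∪ N.right) = ((N.left ∪ N.right)ᶜ ∩ V)ᶜ := by
      ext x
      have h1 := @hUV x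
      have h2 : x ∉ (N.left ∪ N.right)ᶜ ∩ (U ∩ V) := by rw [hdisj]; exact id
      simp only [mem_inter_iff, mem_union, mem_compl_iff] at *
      tauto
    refine N.exists_separation hirr (hG.inter hU) ?_ ?_
    · rw [heq]
      exact (hG.inter hV).isClosed_compl
    · intro h
      exact hnU fun x hx => ((h ▸ mem_univ x :
        x ∈ ((N.left ∪ N.right)ᶜ ∩ U) ∪ (N.left ∪ N.right)).resolve_right hx).2
  obtain ⟨C, D, hC, hD, hCD, hu, hlC, hrD⟩ := key U V hU hV hUV hdisj hnU
  obtain ⟨C', D', hC', hD', hCD', hu', hlC', hrD'⟩ :=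
    key V U hV hU (by rwa [union_comm V]) (by rwa [inter_comm V]) hnV
  have hcross : ∀ x, (x ∈ C ∪ C' → x ∉ D ∪ D') ∧ x ∈ (C ∪ C') ∪ (D ∪ D') := by
    intro x
    have h1 := @hUV x
    have h2 : x ∉ (N.left ∪ N.right)ᶜ ∩ (U ∩ V) := by rw [hdisj]; exact id
    have h3 := Set.ext_iff.1 hu x
    have h4 := Set.ext_iff.1 hu' x
    have h5 := @hlC x
    have h6 := @hrD x
    have h7 := @hlC' x
    have h8 := @hrD' x
    have h9 : x ∈ C → x ∉ D := fun h h' => hCD.le_bot ⟨h, h'⟩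
    have h10 : x ∈ C' → x ∉ D' := fun h h' => hCD'.le_bot ⟨h, h'⟩
    simp only [mem_inter_iff, mem_union, mem_compl_iff] at h1 h2 h3 h4 ⊢
    grind
  have hcompl : (C ∪ C')ᶜ = D ∪ D' := by
    ext x
    exact ⟨fun h => (hcross x).2.resolve_left h, fun h h' => (hcross x).1 h' h⟩
  have hclopen : IsClopen (C ∪ C') :=
    ⟨hC.union hC', isClosed_compl_iff.1 (hcompl ▸ hD.union hD')⟩
  rcases isClopen_iff.1 hclopen with h | h
  · exact (h ▸ (.inl (hlC N.mem_left) : a ∈ C ∪ C') : a ∈ (∅ : Set P))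
  · exact (hcross b).1 (h ▸ mem_univ b) (.inl (hrD N.mem_right))

lemma EndPair.isPreconnected_gap [PreconnectedSpace P] (hirr : IsIrreducibleBetween a b)
    (N : EndPair a b) :
    IsPreconnected N.gap :=
  (N.isPreconnected_compl hirr).closure

lemma EndPair.left_inter_gap_nonempty [PreconnectedSpace P] (N : EndPair a b) :
    (N.left ∩ N.gap).Nonempty := by
  by_contra h
  rw [not_nonempty_iff_eq_empty] at h
  have hcompl : N.leftᶜ = N.gap ∪ N.right := by
    ext x
    have h1 : x ∉ N.left ∩ N.gap := by rw [h]; exact id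
    have h2 : x ∈ N.left ∪ N.gap ∪ N.right := N.left_union_gap_union_right ▸ mem_univ x
    have h3 : x ∈ N.left → x ∉ N.right := fun h h' => N.disjoint.le_bot ⟨h, h'⟩
    simp only [mem_inter_iff, mem_union, mem_compl_iff] at *
    tauto
  have hclopen : IsClopen N.left := ⟨N.isClosed_left,
    isClosed_compl_iff.1 (hcompl ▸ isClosed_closure.union N.isClosed_right)⟩
  rcases isClopen_iff.1 hclopen with h | h
  · exact (h ▸ N.mem_left : a ∈ (∅ : Set P))
  · exact N.disjoint.le_bot ⟨h ▸ mem_univ b, N.mem_right⟩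

/-- Exchange the roles of `a` and `b`. -/
def EndPair.swap (N : EndPair a b) : EndPair b a :=
  ⟨N.right, N.left, N.isClosed_right, N.isClosed_left, N.isPreconnected_right,
    N.isPreconnected_left, N.mem_right, N.mem_left, N.disjoint.symm⟩

lemma EndPair.gap_swap (N : EndPair a b) : N.swap.gap = N.gap := by
  simp only [EndPair.gap, EndPair.swap, union_comm]

lemma EndPair.right_inter_gap_nonempty [PreconnectedSpace P] (N : EndPair a b) :
    (N.right ∩ N.gap).Nonempty := by
  have := N.swap.left_inter_gap_nonempty
  rwa [N.gap_swap] at this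

lemma EndPair.eq_gap_of_meets (hirr : IsIrreducibleBetween a b) (N : EndPair a b) {Q : Set P}
    (hQ : IsClosed Q) (hQp : IsPreconnected Q) (hsub : Q ⊆ N.gap) (hl : (N.left ∩ Q).Nonempty)
    (hr : (Q ∩ N.right).Nonempty) : Q = N.gap := by
  have hp : IsPreconnected (N.left ∪ Q ∪ N.right) := by
    refine (N.isPreconnected_left.union' hl hQp).union' ?_ N.isPreconnected_right
    obtain ⟨x, hx1, hx2⟩ := hr
    exact ⟨x, .inr hx1, hx2⟩
  have huniv := hirr _ ((N.isClosed_left.union hQ).union N.isClosed_right) hp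
    (.inl (.inl N.mem_left)) (.inr N.mem_right)
  refine hsub.antisymm (closure_minimal (fun x hx => ?_) hQ)
  have h2 : x ∈ N.left ∪ Q ∪ N.right := huniv ▸ mem_univ x
  simp only [mem_union, mem_compl_iff] at *
  tauto

lemma EndPair.exists_between [CompactSpace P] [T2Space P] [SecondCountableTopology P]
    [PreconnectedSpace P] (h : ¬ HasUncountableDisjointSubcontinua P)
    (hirr : IsIrreducibleBetween a b) (N : EndPair a b) :
    ∃ N₁ N₂ : EndPair a b, N₁.left = N.left ∧ N₂.right = N.right ∧
      N₂.left ∪ N₁.right = univ := by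
  obtain ⟨x, hxl, hxg⟩ := N.left_inter_gap_nonempty
  obtain ⟨y, hyr, hyg⟩ := N.right_inter_gap_nonempty
  have hnt : N.gap.Nontrivial :=
    ⟨x, hxg, y, hyg, fun h => N.disjoint.le_bot ⟨hxl, h ▸ hyr⟩⟩
  obtain ⟨A, B, hA, hAp, hB, hBp, hAB, hAne, hBne⟩ :=
    exists_decomposition h isClosed_closure (N.isPreconnected_gap hirr) hnt
  have key : ∀ A B : Set P, IsClosed A → IsPreconnected A → IsClosed B → IsPreconnected B →
      A ∪ B = N.gap → A ≠ N.gap → B ≠ N.gap → x ∈ A → ∃ N₁ N₂ : EndPair a b,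
        N₁.left = N.left ∧ N₂.right = N.right ∧ N₂.left ∪ N₁.right = univ := by
    intro A B hA hAp hB hBp hAB hAne hBne hxA
    have hAr : Disjoint A N.right := by
      rw [disjoint_iff_inter_eq_empty, ← not_nonempty_iff_eq_empty]
      exact fun h => hAne (N.eq_gap_of_meets hirr hA hAp (hAB ▸ subset_union_left) ⟨x, hxl, hxA⟩ h)
    have hyB : y ∈ B := (hAB ▸ hyg : y ∈ A ∪ B).resolve_left fun h => hAr.le_bot ⟨h, hyr⟩
    have hBl : Disjoint N.left B := by
      rw [disjoint_iff_inter_eq_empty, ← not_nonempty_iff_eq_empty]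
      exact fun h => hBne (N.eq_gap_of_meets hirr hB hBp (hAB ▸ subset_union_right) h ⟨y, hyB, hyr⟩)
    refine ⟨⟨N.left, B ∪ N.right, N.isClosed_left, hB.union N.isClosed_right,
        N.isPreconnected_left, hBp.union y hyB hyr N.isPreconnected_right, N.mem_left,
        .inr N.mem_right, disjoint_union_right.2 ⟨hBl, N.disjoint⟩⟩,
      ⟨N.left ∪ A, N.right, N.isClosed_left.union hA, N.isClosed_right,
        N.isPreconnected_left.union x hxl hxA hAp, N.isPreconnected_right, .inl N.mem_left,
        N.mem_right, disjoint_union_left.2 ⟨N.disjoint, hAr⟩⟩, rfl, rfl, ?_⟩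
    change (N.left ∪ A) ∪ (B ∪ N.right) = univ
    rw [← N.left_union_gap_union_right, ← hAB]
    simp only [union_assoc]
  rcases (hAB ▸ hxg : x ∈ A ∪ B) with hx | hx
  · exact key A B hA hAp hB hBp hAB hAne hBne hx
  · exact key B A hB hBp hA hAp (by rwa [union_comm]) hBne hAne hx

/-- The second pair lies strictly inside the first one. -/
def EndPair.Inside (N' N : EndPair a b) : Prop :=
  N.left ⊆ interior N'.left ∧ N.right ⊆ interior N'.right

lemma EndPair.gap_subset_of_inside {N' N : EndPair a b} (h : N'.Inside N) :
    N'.gap ⊆ N.gap :=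
  closure_mono (compl_subset_compl.2 (union_subset_union (h.1.trans interior_subset)
    (h.2.trans interior_subset)))

lemma subset_interior_of_disjoint {A B C : Set P} (hB : IsClosed B) (hAB : Disjoint A B)
    (h : C ∪ B = univ) : A ⊆ interior C :=
  (subset_compl_iff_disjoint_right.2 hAB).trans
    (interior_maximal (fun x hx => (h ▸ mem_univ x : x ∈ C ∪ B).resolve_right hx)
      hB.isOpen_compl)

lemma EndPair.exists_split [CompactSpace P] [T2Space P] [SecondCountableTopology P]
    [PreconnectedSpace P] (h : ¬ HasUncountableDisjointSubcontinua P)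
    (hirr : IsIrreducibleBetween a b) (N : EndPair a b) :
    ∃ N₁ N₂ : EndPair a b, N₁.Inside N ∧ N₂.Inside N ∧ Disjoint N₁.gap N₂.gap := by
  obtain ⟨A₁, A₂, hA₁, hA₂, hA⟩ := N.exists_between h hirr
  obtain ⟨B₁, B₂, hB₁, hB₂, hB⟩ := A₂.exists_between h hirr
  obtain ⟨C₁, C₂, hC₁, hC₂, hC⟩ := B₂.exists_between h hirr
  obtain ⟨D₁, D₂, hD₁, hD₂, hD⟩ := C₂.exists_between h hirr
  have hleft : ∀ {M N₁ N₂ : EndPair a b}, N₁.left = M.left → N₂.left ∪ N₁.right = univ →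
      M.left ⊆ interior N₂.left := fun {M N₁ N₂} e u =>
    subset_interior_of_disjoint N₁.isClosed_right (e ▸ N₁.disjoint) u
  have hright : ∀ {M N₁ N₂ : EndPair a b}, N₂.right = M.right → N₂.left ∪ N₁.right = univ →
      M.right ⊆ interior N₁.right := fun {M N₁ N₂} e u =>
    subset_interior_of_disjoint N₂.isClosed_left (e ▸ N₂.disjoint.symm) (by rwa [union_comm])
  have lA := hleft hA₁ hA
  have lB := hleft hB₁ hB
  have lC := hleft hC₁ hC
  have rB := hright hB₂ hB
  have rD := hright hD₂ hD
  rw [hA₂] at rB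
  rw [hC₂, hB₂, hA₂] at rD
  have hgap : ∀ {M : EndPair a b} {S T : Set P}, IsClosed S → S ∪ T = univ →
      T ⊆ M.left ∪ M.right → M.gap ⊆ S := fun {M S T} hS hST hT =>
    closure_minimal (fun x hx => (hST ▸ mem_univ x : x ∈ S ∪ T).resolve_right
      fun h => hx (hT h)) hS
  have lAC := ((lA.trans interior_subset).trans (lB.trans interior_subset)).trans lC
  have d1 : Disjoint B₂.left C₁.right := hC₁ ▸ C₁.disjoint
  refine ⟨⟨A₂.left, B₁.right, A₂.isClosed_left, B₁.isClosed_right, A₂.isPreconnected_left,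
      B₁.isPreconnected_right, A₂.mem_left, B₁.mem_right, hB₁ ▸ B₁.disjoint⟩,
    ⟨C₂.left, D₁.right, C₂.isClosed_left, D₁.isClosed_right, C₂.isPreconnected_left,
      D₁.isPreconnected_right, C₂.mem_left, D₁.mem_right, hD₁ ▸ D₁.disjoint⟩,
    ⟨lA, rB⟩, ⟨lAC, rD⟩, ?_⟩
  exact d1.mono (hgap B₂.isClosed_left hB subset_union_right)
    (hgap C₁.isClosed_right (by rwa [union_comm]) subset_union_left)

/-- The gap intersection along a sequence of nested pairs, when degenerate, cuts the space. -/
lemma EndPair.exists_cut {N : ℕ → EndPair a b} (hN : ∀ n, (N (n + 1)).Inside (N n)) {c : P}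
    (hc : ⋂ n, (N n).gap = {c}) :
    ∃ A B : Set P, IsClosed A ∧ IsClosed B ∧ A ∪ B = univ ∧ A ∩ B = {c} ∧ a ∈ A ∧ b ∈ B ∧
      a ≠ c ∧ b ≠ c := by
  have hL : Monotone fun n => (N n).left :=
    monotone_nat_of_le_succ fun n => (hN n).1.trans interior_subset
  have hR : Monotone fun n => (N n).right :=
    monotone_nat_of_le_succ fun n => (hN n).2.trans interior_subset
  have hLo : IsOpen (⋃ n, (N n).left) := by
    have : ⋃ n, (N n).left = ⋃ n, interior (N n).left :=
      (iUnion_subset fun n => (hN n).1.trans (subset_iUnion_of_subset (n + 1) Subset.rfl)).antisymm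
        (iUnion_mono fun n => interior_subset)
    rw [this]
    exact isOpen_iUnion fun n => isOpen_interior
  have hRo : IsOpen (⋃ n, (N n).right) := by
    have : ⋃ n, (N n).right = ⋃ n, interior (N n).right :=
      (iUnion_subset fun n => (hN n).2.trans (subset_iUnion_of_subset (n + 1) Subset.rfl)).antisymm
        (iUnion_mono fun n => interior_subset)
    rw [this]
    exact isOpen_iUnion fun n => isOpen_interior
  have hdisj : Disjoint (⋃ n, (N n).left) (⋃ n, (N n).right) := by
    rw [disjoint_left]
    intro x hx hx'
    obtain ⟨m, hm⟩ := mem_iUnion.1 hx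
    obtain ⟨n, hn⟩ := mem_iUnion.1 hx'
    exact (N (max m n)).disjoint.le_bot ⟨hL (le_max_left m n) hm, hR (le_max_right m n) hn⟩
  have hcg : ∀ n, c ∈ (N n).gap := fun n => mem_iInter.1 (hc ▸ rfl : c ∈ ⋂ n, (N n).gap) n
  have hgd : ∀ n, Disjoint (N (n + 1)).gap ((N n).left ∪ (N n).right) := fun n => by
    rw [EndPair.gap, closure_compl, disjoint_compl_left_iff_subset]
    exact union_subset ((hN n).1.trans (interior_mono subset_union_left))
      ((hN n).2.trans (interior_mono subset_union_right))
  have hcL : c ∉ ⋃ n, (N n).left := fun h => by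
    obtain ⟨n, hn⟩ := mem_iUnion.1 h
    exact (hgd n).le_bot ⟨hcg _, .inl hn⟩
  have hcR : c ∉ ⋃ n, (N n).right := fun h => by
    obtain ⟨n, hn⟩ := mem_iUnion.1 h
    exact (hgd n).le_bot ⟨hcg _, .inr hn⟩
  have hcover : ∀ x, x ∉ ⋃ n, (N n).left → x ∉ ⋃ n, (N n).right → x = c := by
    intro x h1 h2
    have : x ∈ ⋂ n, (N n).gap := mem_iInter.2 fun n => subset_closure fun h =>
      h.elim (fun h => h1 (mem_iUnion.2 ⟨n, h⟩)) fun h => h2 (mem_iUnion.2 ⟨n, h⟩)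
    rwa [hc] at this
  have haL : a ∈ ⋃ n, (N n).left := mem_iUnion.2 ⟨0, (N 0).mem_left⟩
  have hbR : b ∈ ⋃ n, (N n).right := mem_iUnion.2 ⟨0, (N 0).mem_right⟩
  refine ⟨(⋃ n, (N n).right)ᶜ, (⋃ n, (N n).left)ᶜ, hRo.isClosed_compl, hLo.isClosed_compl,
    ?_, ?_, fun h => hdisj.le_bot ⟨haL, h⟩, fun h => hdisj.le_bot ⟨h, hbR⟩,
    fun h => hcL (h ▸ haL), fun h => hcR (h ▸ hbR)⟩
  · rw [← compl_inter, inter_comm, hdisj.inter_eq, compl_empty]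
  · exact Subset.antisymm (fun x hx => hcover x hx.2 hx.1)
      (singleton_subset_iff.2 ⟨hcR, hcL⟩)

lemma uncountable_nat_to_bool : Uncountable (ℕ → Bool) := by
  refine ⟨fun h => ?_⟩
  have := Cardinal.mk_le_aleph0_iff.2 h
  simp only [Cardinal.mk_pi, Cardinal.prod_const, Cardinal.mk_bool, Cardinal.mk_nat,
    Cardinal.lift_id] at this
  exact (Cardinal.cantor _).not_ge this

/-- An irreducible continuum without uncountably many disjoint non-degenerate subcontinua
has a cut point separating the two points of irreducibility. -/
lemma IsIrreducibleBetween.exists_cut [CompactSpace P] [T2Space P] [SecondCountableTopology P]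
    [PreconnectedSpace P] (hab : a ≠ b) (hirr : IsIrreducibleBetween a b)
    (h : ¬ HasUncountableDisjointSubcontinua P) :
    ∃ (c : P) (A B : Set P), IsClosed A ∧ IsClosed B ∧ A ∪ B = univ ∧ A ∩ B = {c} ∧ a ∈ A ∧
      b ∈ B ∧ a ≠ c ∧ b ≠ c := by
  by_contra hcut
  refine h ?_
  choose s t hs ht hst using fun N : EndPair a b => N.exists_split h hirr
  let start : EndPair a b := ⟨{a}, {b}, isClosed_singleton, isClosed_singleton,
    isPreconnected_singleton, isPreconnected_singleton, rfl, rfl, by simpa using hab⟩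
  obtain ⟨node, hzero, hsucc⟩ : ∃ node : (ℕ → Bool) → ℕ → EndPair a b,
      (∀ σ, node σ 0 = start) ∧
      ∀ σ n, node σ (n + 1) = cond (σ n) (s (node σ n)) (t (node σ n)) :=
    ⟨fun σ n => Nat.rec start (fun n N => cond (σ n) (s N) (t N)) n, fun _ => rfl,
      fun _ _ => rfl⟩
  have hin : ∀ σ n, (node σ (n + 1)).Inside (node σ n) := by
    intro σ n
    rw [hsucc]
    cases σ n
    · exact ht _
    · exact hs _
  have hanti : ∀ σ, Antitone fun n => (node σ n).gap := fun σ =>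
    antitone_nat_of_succ_le fun n => EndPair.gap_subset_of_inside (hin σ n)
  have := uncountable_nat_to_bool
  refine .of_indexed (fun σ : ℕ → Bool => ⋂ n, (node σ n).gap) (fun σ => ?_) fun σ τ hne => ?_
  · have hd : Directed (· ⊇ ·) fun n => (node σ n).gap := (hanti σ).directed_ge
    have hnonempty : (⋂ n, (node σ n).gap).Nonempty :=
      IsCompact.nonempty_iInter_of_directed_nonempty_isCompact_isClosed _ hd
        (fun n => (node σ n).left_inter_gap_nonempty.mono inter_subset_right)
        (fun n => isClosed_closure.isCompact) fun n => isClosed_closure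
    refine ⟨⟨(isClosed_iInter fun n => isClosed_closure).isCompact, hnonempty,
      isPreconnected_iInter_of_directed hd (fun n => isClosed_closure)
        fun n => (node σ n).isPreconnected_gap hirr⟩, ?_⟩
    by_contra hnt
    rw [not_nontrivial_iff] at hnt
    obtain ⟨c, hc⟩ := hnonempty
    exact hcut ⟨c, EndPair.exists_cut (hin σ) (hnt.eq_singleton_of_mem hc)⟩
  · have hex : ∃ n, σ n ≠ τ n := Function.ne_iff.1 hne
    classical
    have hn := Nat.find_spec hex
    have hlt : ∀ m, m < Nat.find hex → σ m = τ m := fun m hm => not_not.1 (Nat.find_min hex hm)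
    generalize Nat.find hex = n at hn hlt
    have heq : ∀ m ≤ n, node σ m = node τ m := by
      intro m
      induction m with
      | zero => exact fun _ => (hzero σ).trans (hzero τ).symm
      | succ m ih =>
        intro hm
        rw [hsucc, hsucc, ih (by lia), hlt m (by lia)]
    have hd : Disjoint (node σ (n + 1)).gap (node τ (n + 1)).gap := by
      rw [hsucc, hsucc, heq n le_rfl]
      cases h1 : σ n <;> cases h2 : τ n
      · exact (hn (h1.trans h2.symm)).elim
      · exact (hst _).symm
      · exact hst _
      · exact (hn (h1.trans h2.symm)).elim
    exact hd.mono (iInter_subset _ _) (iInter_subset _ _)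

end Irreducible

section Existence

variable {X : Type*} [TopologicalSpace X] [CompactSpace X] [T2Space X]

lemma exists_irreducible_subcontinuum [PreconnectedSpace X] (a b : X) :
    ∃ P : Set X, IsClosed P ∧ IsPreconnected P ∧ a ∈ P ∧ b ∈ P ∧
      ∀ Q ⊆ P, IsClosed Q → IsPreconnected Q → a ∈ Q → b ∈ Q → Q = P := by
  obtain ⟨P, -, hP⟩ := zorn_superset_nonempty
    {Q : Set X | IsClosed Q ∧ IsPreconnected Q ∧ a ∈ Q ∧ b ∈ Q} (fun 𝒦 h𝒦 hchain hne => by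
      have : Nonempty 𝒦 := hne.to_subtype
      refine ⟨⋂₀ 𝒦, ⟨isClosed_sInter fun s hs => (h𝒦 hs).1, ?_, fun s hs => (h𝒦 hs).2.2.1,
        fun s hs => (h𝒦 hs).2.2.2⟩, fun s hs => sInter_subset_of_mem hs⟩
      rw [sInter_eq_iInter]
      refine isPreconnected_iInter_of_directed (fun s t => ?_) (fun s => (h𝒦 s.2).1)
        fun s => (h𝒦 s.2).2.1
      rcases hchain.total s.2 t.2 with h | h
      · exact ⟨s, Subset.rfl, h⟩
      · exact ⟨t, h, Subset.rfl⟩)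
    univ ⟨isClosed_univ, isPreconnected_univ, mem_univ a, mem_univ b⟩
  exact ⟨P, hP.prop.1, hP.prop.2.1, hP.prop.2.2.1, hP.prop.2.2.2,
    fun Q hQP h1 h2 h3 h4 => hP.eq_of_subset ⟨h1, h2, h3, h4⟩ hQP⟩

end Existence

theorem statement16 {X : Type*} [TopologicalSpace X]
    [CompactSpace X] [T2Space X] [ConnectedSpace X] [Nontrivial X]
    [TopologicalSpace.MetrizableSpace X]
    (hCook : ∀ P : Set X, IsSubcontinuum P → P.Nontrivial →
      ∀ g : ↥P → X, Continuous g →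
        (∀ p : ↥P, g p = (p : X)) ∨ ∃ c : X, ∀ p : ↥P, g p = c) :
    ∃ 𝒞 : Set (Set X), ¬ 𝒞.Countable ∧
      (∀ A ∈ 𝒞, IsSubcontinuum A ∧ A.Nontrivial) ∧
      𝒞.Pairwise (fun A B => Disjoint A B) := by
  by_contra hS
  obtain ⟨a, b, hab⟩ := exists_pair_ne X
  obtain ⟨P, hP, hPp, haP, hbP, hmin⟩ := exists_irreducible_subcontinuum a b
  have hPc : CompactSpace P := isCompact_iff_compactSpace.1 hP.isCompact
  have : PreconnectedSpace P := isPreconnected_iff_preconnectedSpace.1 hPp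
  let := TopologicalSpace.metrizableSpaceMetric X
  have : SecondCountableTopology X := inferInstance
  have hirr : IsIrreducibleBetween (⟨a, haP⟩ : P) ⟨b, hbP⟩ := by
    intro Q hQ hQp haQ hbQ
    have := hmin ((↑) '' Q) (by rintro _ ⟨x, -, rfl⟩; exact x.2)
      (hP.isClosedEmbedding_subtypeVal.isClosedMap _ hQ)
      (hQp.image _ continuous_subtype_val.continuousOn) ⟨_, haQ, rfl⟩ ⟨_, hbQ, rfl⟩
    refine Subtype.val_injective.image_injective ?_
    rw [this, image_univ, Subtype.range_val]
  have hS' : ¬ HasUncountableDisjointSubcontinua P := fun h =>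
    hS (h.of_injective continuous_subtype_val Subtype.val_injective)
  obtain ⟨c, A, B, hA, hB, hAB, hcap, haA, hbB, hac, hbc⟩ :=
    hirr.exists_cut (fun h => hab (congrArg Subtype.val h)) hS'
  classical
  let g : P → X := fun x => if x ∈ A then x else c
  have hgA : EqOn g (↑) A := fun x hx => if_pos hx
  have hgB : EqOn g (fun _ => (c : X)) B := fun x hx => by
    by_cases hxA : x ∈ A
    · have : x = c := (hcap ▸ ⟨hxA, hx⟩ : x ∈ ({c} : Set P))
      rw [this]
      exact ite_self _
    · exact if_neg hxA
  have hg : Continuous g := by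
    rw [← continuousOn_univ, ← hAB]
    exact (continuous_subtype_val.continuousOn.congr hgA).union_of_isClosed
      (continuousOn_const.congr hgB) hA hB
  rcases hCook P ⟨hP.isCompact, ⟨a, haP⟩, hPp⟩ ⟨a, haP, b, hbP, hab⟩ g hg with h | ⟨d, hd⟩
  · exact hbc (Subtype.ext ((h _).symm.trans (hgB hbB)))
  · refine hac (Subtype.ext ?_)
    exact (hgA haA).symm.trans ((hd _).trans ((hd _).symm.trans (hgB hbB)))
end
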